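/- arXiv:1409.7940 — 4 statements merged into one kernel-verified Lean document; each statement's English description precedes it below -/
import Mathlib

section
/- Convergence of embedding times: Let (ρ^N_k), N ∈ ℕ, 1 ≤ k ≤ N, be nonnegative integrable random variables on a probability space such that for each N the variables ρ^N_1, …, ρ^N_N are pairwise uncorrelated (E[ρ^N_k ρ^N_l] = E[ρ^N_k]·E[ρ^N_l] for k ≠ l), E[ρ^N_k] = 1/N for every k, and the family (N·ρ^N_k)_{N ∈ ℕ, 1 ≤ k ≤ N} is uniformly integrable. Then for every s ∈ [0,1], the sums τ^N(⌊Ns⌋) := ∑_{k=1}^{⌊Ns⌋} ρ^N_k converge to s in probability as N → ∞. -/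
open MeasureTheory Filter Set Topology
open scoped ENNReal

/-- Second-moment bound for a truncated sum of nonnegative variables whose pairwise products have
mean at most the square of the common mean. Truncation can only decrease these products, so no
second moments of the original variables are needed. -/
theorem integral_sq_sum_min_sub_le {Ω ι : Type*} [MeasurableSpace Ω] (P : Measure Ω)
    [IsProbabilityMeasure P] (t : Finset ι) (X : ι → Ω → ℝ) {c M e : ℝ} (hc : 0 ≤ c) (hM : 0 ≤ M)
    (hmeas : ∀ i, Measurable (X i)) (hnonneg : ∀ i ω, 0 ≤ X i ω)
    (hprod : ∀ i ∈ t, ∀ j ∈ t, i ≠ j →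
      Integrable (fun ω => X i ω * X j ω) P ∧ ∫ ω, X i ω * X j ω ∂P ≤ c ^ 2)
    (htrunc : ∀ i ∈ t, c - e ≤ ∫ ω, min (X i ω) M ∂P) :
    Integrable (fun ω => ((∑ i ∈ t, min (X i ω) M) - t.card * c) ^ 2) P ∧
    ∫ ω, ((∑ i ∈ t, min (X i ω) M) - t.card * c) ^ 2 ∂P
      ≤ t.card * M ^ 2 + 2 * (t.card : ℝ) ^ 2 * c * e := by
  classical
  have hY0 : ∀ i ω, 0 ≤ min (X i ω) M := fun i ω => le_min (hnonneg i ω) hM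
  have hYm : ∀ i, Measurable fun ω => min (X i ω) M := fun i => (hmeas i).min measurable_const
  have hYint : ∀ i, Integrable (fun ω => min (X i ω) M) P := fun i =>
    Integrable.of_bound (hYm i).aestronglyMeasurable M <| ae_of_all _ fun ω => by
      rw [Real.norm_of_nonneg (hY0 i ω)]; exact min_le_right _ _
  have hle : ∀ i j ω, min (X i ω) M * min (X j ω) M ≤ M ^ 2 := fun i j ω => by
    rw [sq]; exact mul_le_mul (min_le_right _ _) (min_le_right _ _) (hY0 j ω) hM
  have hYYint : ∀ i j, Integrable (fun ω => min (X i ω) M * min (X j ω) M) P := fun i j =>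
    Integrable.of_bound ((hYm i).mul (hYm j)).aestronglyMeasurable (M ^ 2) <| ae_of_all _ fun ω => by
      rw [Real.norm_of_nonneg (mul_nonneg (hY0 i ω) (hY0 j ω))]; exact hle i j ω
  have hYY : ∀ i ∈ t, ∀ j ∈ t,
      ∫ ω, min (X i ω) M * min (X j ω) M ∂P ≤ c ^ 2 + if i = j then M ^ 2 else 0 := by
    intro i hi j hj
    split_ifs with h
    · have := integral_mono (hYYint i j) (integrable_const (M ^ 2)) (hle i j)
      simp only [integral_const, probReal_univ, one_smul] at this
      nlinarith [sq_nonneg c]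
    · rw [add_zero]
      refine (integral_mono (hYYint i j) (hprod i hi j hj h).1 fun ω => ?_).trans
        (hprod i hi j hj h).2
      exact mul_le_mul (min_le_left _ _) (min_le_left _ _) (hY0 j ω) (hnonneg i ω)
  have hexp : (fun ω => ((∑ i ∈ t, min (X i ω) M) - t.card * c) ^ 2) = fun ω =>
      (∑ i ∈ t, ∑ j ∈ t, min (X i ω) M * min (X j ω) M)
        - 2 * (t.card * c) * (∑ i ∈ t, min (X i ω) M) + (t.card * c) ^ 2 := by
    funext ω
    rw [← Finset.sum_mul_sum]
    ring
  have hI1 : Integrable (fun ω => ∑ i ∈ t, ∑ j ∈ t, min (X i ω) M * min (X j ω) M) P :=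
    integrable_finsetSum _ fun i _ => integrable_finsetSum _ fun j _ => hYYint i j
  have hI2 : Integrable (fun ω => 2 * (t.card * c) * (∑ i ∈ t, min (X i ω) M)) P :=
    (integrable_finsetSum _ fun i _ => hYint i).const_mul _
  have hI12 : Integrable (fun ω => (∑ i ∈ t, ∑ j ∈ t, min (X i ω) M * min (X j ω) M)
      - 2 * (t.card * c) * (∑ i ∈ t, min (X i ω) M)) P := hI1.sub hI2
  rw [hexp]
  refine ⟨hI12.add (integrable_const _), ?_⟩
  rw [integral_add hI12 (integrable_const _), integral_sub hI1 hI2, integral_const_mul,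
    integral_finsetSum _ fun i _ => hYint i,
    integral_finsetSum _ fun i _ => integrable_finsetSum _ fun j _ => hYYint i j]
  simp only [integral_const, probReal_univ, one_smul]
  have h1 : ∑ i ∈ t, ∫ ω, ∑ j ∈ t, min (X i ω) M * min (X j ω) M ∂P
      ≤ (t.card : ℝ) ^ 2 * c ^ 2 + t.card * M ^ 2 := by
    calc _ ≤ ∑ i ∈ t, ∑ j ∈ t, (c ^ 2 + if i = j then M ^ 2 else 0) := by
          refine Finset.sum_le_sum fun i hi => ?_
          rw [integral_finsetSum _ fun j _ => hYYint i j]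
          exact Finset.sum_le_sum fun j hj => hYY i hi j hj
      _ = _ := by
          simp [Finset.sum_add_distrib]
          ring
  have h2 : t.card * (c - e) ≤ ∑ i ∈ t, ∫ ω, min (X i ω) M ∂P := by
    simpa using Finset.card_nsmul_le_sum t _ _ htrunc
  have h3 := mul_le_mul_of_nonneg_left h2 (by positivity : 0 ≤ 2 * ((t.card : ℝ) * c))
  nlinarith

/-- A quantitative weak law in `L¹` for nonnegative variables with products of mean at most the
square of the common mean: `e` bounds the mean lost by truncating at level `M`. -/
theorem integral_abs_sum_sub_le {Ω ι : Type*} [MeasurableSpace Ω] (P : Measure Ω)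
    [IsProbabilityMeasure P] (t : Finset ι) (X : ι → Ω → ℝ) {c M e δ : ℝ} (hc : 0 ≤ c) (hM : 0 ≤ M)
    (hδ : 0 < δ) (hmeas : ∀ i, Measurable (X i)) (hnonneg : ∀ i ω, 0 ≤ X i ω)
    (hint : ∀ i ∈ t, Integrable (X i) P)
    (hprod : ∀ i ∈ t, ∀ j ∈ t, i ≠ j →
      Integrable (fun ω => X i ω * X j ω) P ∧ ∫ ω, X i ω * X j ω ∂P ≤ c ^ 2)
    (hmean : ∀ i ∈ t, ∫ ω, X i ω ∂P = c)
    (htrunc : ∀ i ∈ t, ∫ ω, (X i ω - min (X i ω) M) ∂P ≤ e) :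
    ∫ ω, |(∑ i ∈ t, X i ω) - t.card * c| ∂P
      ≤ t.card * e + δ / 2 + (t.card * M ^ 2 + 2 * (t.card : ℝ) ^ 2 * c * e) / (2 * δ) := by
  have hYint : ∀ i ∈ t, Integrable (fun ω => min (X i ω) M) P := fun i hi =>
    (hint i hi).inf (integrable_const M)
  have htrunc' : ∀ i ∈ t, c - e ≤ ∫ ω, min (X i ω) M ∂P := fun i hi => by
    have := htrunc i hi
    rw [integral_sub (hint i hi) (hYint i hi), hmean i hi] at this
    linarith
  obtain ⟨hI, hle⟩ := integral_sq_sum_min_sub_le P t X hc hM hmeas hnonneg hprod htrunc'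
  have hXY : ∀ i ∈ t, Integrable (fun ω => X i ω - min (X i ω) M) P := fun i hi =>
    (hint i hi).sub (hYint i hi)
  have hD : Integrable (fun ω => ∑ i ∈ t, (X i ω - min (X i ω) M)) P :=
    integrable_finsetSum _ hXY
  have hQ := hI.div_const (2 * δ)
  have hpt : ∀ ω, |(∑ i ∈ t, X i ω) - t.card * c| ≤ (∑ i ∈ t, (X i ω - min (X i ω) M)) + δ / 2
      + ((∑ i ∈ t, min (X i ω) M) - t.card * c) ^ 2 / (2 * δ) := by
    intro ω
    have h0 : 0 ≤ ∑ i ∈ t, (X i ω - min (X i ω) M) :=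
      Finset.sum_nonneg fun i _ => sub_nonneg.2 (min_le_left _ _)
    have hsplit : (∑ i ∈ t, X i ω) - t.card * c = (∑ i ∈ t, (X i ω - min (X i ω) M))
        + ((∑ i ∈ t, min (X i ω) M) - t.card * c) := by
      rw [Finset.sum_sub_distrib]; ring
    rw [hsplit]
    generalize (∑ i ∈ t, min (X i ω) M) - t.card * c = u
    have hu : |u| ≤ δ / 2 + u ^ 2 / (2 * δ) := by
      rw [← sq_abs u, div_add_div _ _ two_ne_zero (by positivity), le_div_iff₀ (by positivity)]
      nlinarith [sq_nonneg (|u| - δ)]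
    have := abs_add_le (∑ i ∈ t, (X i ω - min (X i ω) M)) u
    rw [abs_of_nonneg h0] at this
    linarith
  have hS : Integrable (fun ω => |(∑ i ∈ t, X i ω) - t.card * c|) P :=
    ((integrable_finsetSum _ hint).sub (integrable_const _)).abs
  have hDC := hD.add (integrable_const (μ := P) (δ / 2))
  refine (integral_mono hS (hDC.add hQ) hpt).trans ?_
  rw [integral_add' hDC hQ, integral_add' hD (integrable_const _), integral_div (2 * δ),
    integral_finsetSum _ hXY]
  simp only [integral_const, probReal_univ, one_smul]
  have := Finset.sum_le_card_nsmul t _ _ htrunc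
  rw [nsmul_eq_mul] at this
  gcongr

/-- **Convergence of the embedding times.**
Let `(ρ N k)`, `N ∈ ℕ`, `1 ≤ k ≤ N`, be nonnegative integrable random variables such that for
each `N` the variables `ρ N 1, …, ρ N N` are pairwise uncorrelated, `E[ρ N k] = 1/N`, and the
family `(N · ρ N k)` is uniformly integrable.  Then for every `s ∈ [0,1]` the sums
`τ^N(⌊Ns⌋) = ∑_{k=1}^{⌊Ns⌋} ρ N k` converge to `s` in probability as `N → ∞`. -/
theorem embedding_times_tendsto_inMeasure
    {Ω : Type*} [MeasurableSpace Ω] (P : Measure Ω) [IsProbabilityMeasure P]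
    (ρ : ℕ → ℕ → Ω → ℝ)
    (hmeas : ∀ N k, Measurable (ρ N k))
    (hnonneg : ∀ N k ω, 0 ≤ ρ N k ω)
    (hint : ∀ N k, 1 ≤ k → k ≤ N → Integrable (ρ N k) P)
    (hmean : ∀ N k, 1 ≤ k → k ≤ N → ∫ ω, ρ N k ω ∂P = 1 / (N : ℝ))
    -- pairwise uncorrelated for each fixed `N`
    (huncorr : ∀ N k l, 1 ≤ k → k < l → l ≤ N →
      Integrable (fun ω => ρ N k ω * ρ N l ω) P ∧
      ∫ ω, ρ N k ω * ρ N l ω ∂P = (∫ ω, ρ N k ω ∂P) * (∫ ω, ρ N l ω ∂P))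
    -- uniform integrability of the family `(N · ρ N k)`
    (hUI : ∀ ε > (0 : ℝ), ∃ y₀ : ℝ, ∀ y ≥ y₀, ∀ (N k : ℕ), 1 ≤ k → k ≤ N →
      ∫ ω in {ω | y < |(N : ℝ) * ρ N k ω|}, |(N : ℝ) * ρ N k ω| ∂P ≤ ε) :
    ∀ s ∈ Set.Icc (0 : ℝ) 1, ∀ ε > (0 : ℝ),
      Tendsto
        (fun N : ℕ =>
          P {ω | ε < |(∑ k ∈ Finset.Icc 1 ⌊(N : ℝ) * s⌋₊, ρ N k ω) - s|})
        atTop (𝓝 0) := by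
  intro s hs ε hε
  set m : ℕ → ℕ := fun N => ⌊(N : ℝ) * s⌋₊
  have hmN : ∀ N, m N ≤ N := fun N =>
    Nat.floor_le_of_le (mul_le_of_le_one_right N.cast_nonneg hs.2)
  have hSint : ∀ N, Integrable (fun ω => |(∑ k ∈ Finset.Icc 1 (m N), ρ N k ω) - s|) P := fun N =>
    ((integrable_finsetSum _ fun k hk => hint N k (Finset.mem_Icc.1 hk).1
      ((Finset.mem_Icc.1 hk).2.trans (hmN N))).sub (integrable_const _)).abs
  -- convergence in `L¹`
  have hL1 : Tendsto (fun N => ∫ ω, |(∑ k ∈ Finset.Icc 1 (m N), ρ N k ω) - s| ∂P) atTop (𝓝 0) := by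
    have hbound : ∀ δ > (0 : ℝ), ∃ M : ℝ, ∀ N : ℕ, 0 < N →
        ∫ ω, |(∑ k ∈ Finset.Icc 1 (m N), ρ N k ω) - s| ∂P
          ≤ δ ^ 2 + δ / 2 + δ + (M ^ 2 / (2 * δ) + 1) * (1 / (N : ℝ)) := by
      intro δ hδ
      obtain ⟨y₀, hy₀⟩ := hUI (δ ^ 2) (by positivity)
      refine ⟨max y₀ 0, fun N hN => ?_⟩
      have hUIM := hy₀ _ (le_max_left y₀ 0) N
      have hM0 : 0 ≤ max y₀ 0 := le_max_right _ _
      generalize max y₀ 0 = M at hUIM hM0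
      have hNpos : (0 : ℝ) < N := by exact_mod_cast hN
      have hk : ∀ k ∈ Finset.Icc 1 (m N), 1 ≤ k ∧ k ≤ N := fun k hk =>
        ⟨(Finset.mem_Icc.1 hk).1, (Finset.mem_Icc.1 hk).2.trans (hmN N)⟩
      have hprod : ∀ i ∈ Finset.Icc 1 (m N), ∀ j ∈ Finset.Icc 1 (m N), i ≠ j →
          Integrable (fun ω => ρ N i ω * ρ N j ω) P ∧
            ∫ ω, ρ N i ω * ρ N j ω ∂P ≤ (1 / (N : ℝ)) ^ 2 := by
        intro i hi j hj hij
        have hlt : ∀ i ∈ Finset.Icc 1 (m N), ∀ j ∈ Finset.Icc 1 (m N), i < j →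
            Integrable (fun ω => ρ N i ω * ρ N j ω) P ∧
              ∫ ω, ρ N i ω * ρ N j ω ∂P ≤ (1 / (N : ℝ)) ^ 2 := by
          intro i hi j hj hij
          obtain ⟨h1, h2⟩ := huncorr N i j (hk i hi).1 hij (hk j hj).2
          refine ⟨h1, ?_⟩
          rw [h2, hmean N i (hk i hi).1 (hk i hi).2, hmean N j (hk j hj).1 (hk j hj).2, sq]
        rcases hij.lt_or_gt with h | h
        · exact hlt i hi j hj h
        · simpa only [mul_comm] using hlt j hj i hi h
      have htrunc : ∀ k ∈ Finset.Icc 1 (m N),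
          ∫ ω, (ρ N k ω - min (ρ N k ω) (M / N)) ∂P ≤ δ ^ 2 / N := by
        intro k hk'
        have hi := hint N k (hk k hk').1 (hk k hk').2
        have hiN : Integrable (fun ω => |(N : ℝ) * ρ N k ω|) P := (hi.const_mul _).abs
        have hset : MeasurableSet {ω | M < |(N : ℝ) * ρ N k ω|} :=
          measurableSet_lt measurable_const ((hmeas N k).const_mul _).abs
        have hU := hUIM k (hk k hk').1 (hk k hk').2
        rw [← integral_indicator hset] at hU
        rw [le_div_iff₀ hNpos, mul_comm, ← integral_const_mul]
        refine (integral_mono ((hi.sub (hi.inf (integrable_const _))).const_mul _)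
          (hiN.indicator hset) fun ω => ?_).trans hU
        have h0 : 0 ≤ (N : ℝ) * ρ N k ω := mul_nonneg hNpos.le (hnonneg N k ω)
        simp only [Set.indicator_apply, Set.mem_ofPred_eq, abs_of_nonneg h0, Pi.sub_apply,
          Pi.inf_apply]
        split_ifs with h
        · have : 0 ≤ min (ρ N k ω) (M / N) := le_min (hnonneg N k ω) (by positivity)
          exact mul_le_mul_of_nonneg_left (sub_le_self _ this) hNpos.le
        · have : ρ N k ω ≤ M / N := by
            rw [le_div_iff₀ hNpos]; linarith
          simp [min_eq_left this]
      have key := integral_abs_sum_sub_le P (Finset.Icc 1 (m N)) (ρ N)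
        (c := 1 / (N : ℝ)) (M := M / N) (e := δ ^ 2 / N) (by positivity) (by positivity) hδ
        (hmeas N) (hnonneg N) (fun k h => hint N k (hk k h).1 (hk k h).2) hprod
        (fun k h => hmean N k (hk k h).1 (hk k h).2) htrunc
      simp only [Nat.card_Icc, Nat.add_sub_cancel] at key
      have hSint' : Integrable
          (fun ω => |(∑ k ∈ Finset.Icc 1 (m N), ρ N k ω) - m N * (1 / (N : ℝ))|) P :=
        ((integrable_finsetSum _ fun k h => hint N k (hk k h).1 (hk k h).2).sub
          (integrable_const _)).abs
      have hfloor : |(m N : ℝ) * (1 / N) - s| ≤ 1 / N := by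
        have h1 : (m N : ℝ) ≤ N * s := Nat.floor_le (mul_nonneg hNpos.le hs.1)
        have h2 : (N : ℝ) * s < m N + 1 := Nat.lt_floor_add_one _
        have h3 : (m N : ℝ) * (1 / N) - s = (m N - N * s) / N := by field_simp
        rw [h3, abs_div, abs_of_pos hNpos]
        gcongr
        rw [abs_le]
        constructor <;> linarith
      have hstep : ∫ ω, |(∑ k ∈ Finset.Icc 1 (m N), ρ N k ω) - s| ∂P
          ≤ ∫ ω, |(∑ k ∈ Finset.Icc 1 (m N), ρ N k ω) - m N * (1 / (N : ℝ))| ∂P + 1 / N := by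
        have := integral_mono (hSint N) (hSint'.add (integrable_const (1 / (N : ℝ)))) fun ω =>
          (abs_sub_le _ ((m N : ℝ) * (1 / N)) _).trans (add_le_add_right hfloor _)
        rwa [integral_add' hSint' (integrable_const _), integral_const, probReal_univ,
          one_smul] at this
      have hr : (m N : ℝ) / N ≤ 1 := by
        rw [div_le_one hNpos]; exact_mod_cast hmN N
      have hr0 : 0 ≤ (m N : ℝ) / N := by positivity
      have e1 : (m N : ℝ) * (δ ^ 2 / N) ≤ δ ^ 2 := by
        calc _ = (m N : ℝ) / N * δ ^ 2 := by ring
          _ ≤ 1 * δ ^ 2 := by gcongr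
          _ = _ := one_mul _
      have e2 : ((m N : ℝ) * (M / N) ^ 2 + 2 * (m N : ℝ) ^ 2 * (1 / N) * (δ ^ 2 / N)) / (2 * δ)
          ≤ M ^ 2 / (2 * δ) * (1 / N) + δ := by
        calc _ = (m N : ℝ) / N * (M ^ 2 / (2 * δ) * (1 / N)) + ((m N : ℝ) / N) ^ 2 * δ := by
              field_simp
          _ ≤ 1 * (M ^ 2 / (2 * δ) * (1 / N)) + 1 ^ 2 * δ := by gcongr
          _ = _ := by ring
      linarith
    refine tendsto_order.2 ⟨fun a ha => Eventually.of_forall fun N =>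
      ha.trans_le (integral_nonneg fun ω => abs_nonneg _), fun a ha => ?_⟩
    have hδ : 0 < min 1 (a / 4) := by positivity
    obtain ⟨M, hM⟩ := hbound _ hδ
    have hδ1 : min 1 (a / 4) ≤ 1 := min_le_left _ _
    have hδa : min 1 (a / 4) ≤ a / 4 := min_le_right _ _
    generalize min 1 (a / 4) = δ at hδ hM hδ1 hδa
    have hlim : Tendsto (fun N : ℕ => (M ^ 2 / (2 * δ) + 1) * (1 / (N : ℝ))) atTop (𝓝 0) := by
      simpa only [mul_zero] using
        (tendsto_one_div_atTop_nhds_zero_nat (𝕜 := ℝ)).const_mul (M ^ 2 / (2 * δ) + 1)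
    filter_upwards [hlim.eventually_lt_const (by positivity : 0 < a / 4), eventually_gt_atTop 0]
      with N h1 h2
    have := hM N h2
    nlinarith
  have hle : ∀ N, P {ω | ε < |(∑ k ∈ Finset.Icc 1 (m N), ρ N k ω) - s|}
      ≤ ENNReal.ofReal ((∫ ω, |(∑ k ∈ Finset.Icc 1 (m N), ρ N k ω) - s| ∂P) / ε) := by
    intro N
    have hMarkov := mul_meas_ge_le_integral_of_nonneg (ae_of_all _ fun ω => abs_nonneg _)
      (hSint N) ε
    refine (measure_mono (t := {ω | ε ≤ |(∑ k ∈ Finset.Icc 1 (m N), ρ N k ω) - s|})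
      fun ω (h : ε < _) => h.le).trans ?_
    rw [← ofReal_measureReal]
    apply ENNReal.ofReal_le_ofReal
    rwa [le_div_iff₀ hε, mul_comm]
  refine tendsto_of_tendsto_of_tendsto_of_le_of_le tendsto_const_nhds ?_ (fun _ => zero_le) hle
  simpa using ENNReal.tendsto_ofReal (hL1.div_const ε)
end

section
/- Suppose l = −∞, r = ∞, and condition (A1): G_y(a) < ∞ for all y ∈ ℝ and a > 0. Then for every y ∈ ℝ the map G_y is a strictly increasing continuous bijection from [0,∞) onto [0,∞); in particular G_y(0) = 0 and G_y(a) → ∞ as a → ∞. -/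
open MeasureTheory Filter Set Topology
open scoped ENNReal

/-- The integrand `2/η(z)²`, valued in `[0,∞]` (it equals `∞` where `η` vanishes). -/
noncomputable def qIntegrand (η : ℝ → ℝ) (z : ℝ) : ℝ≥0∞ :=
  2 / ENNReal.ofReal ((η z) ^ 2)

/-- `q(y,x) = ∫_y^x ∫_y^u 2/η(z)² dz du ∈ [0,∞]`, the oriented iterated integral (nonnegative
also for `x < y`, since both orientations flip). -/
noncomputable def qfun (η : ℝ → ℝ) (y x : ℝ) : ℝ≥0∞ :=
  if y ≤ x then ∫⁻ u in Set.Ioc y x, ∫⁻ z in Set.Ioc y u, qIntegrand η z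
  else ∫⁻ u in Set.Ioc x y, ∫⁻ z in Set.Ioc u y, qIntegrand η z

/-- `G_y(a) = ∫_ℝ q(y, y + a x) μ(dx) ∈ [0,∞]`. -/
noncomputable def Gfun (η : ℝ → ℝ) (μ : Measure ℝ) (y a : ℝ) : ℝ≥0∞ :=
  ∫⁻ x, qfun η y (y + a * x) ∂μ

/-- `q(y, ·)` as a real-valued oriented iterated interval integral. -/
noncomputable def qReal (η : ℝ → ℝ) (y x : ℝ) : ℝ :=
  ∫ u in y..x, ∫ z in y..u, 2 / (η z) ^ 2

theorem qIntegrand_eq_ofReal {η : ℝ → ℝ} (hηne : ∀ x, η x ≠ 0) (z : ℝ) :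
    qIntegrand η z = ENNReal.ofReal (2 / (η z) ^ 2) := by
  have h : 0 < (η z) ^ 2 := by have := hηne z; positivity
  rw [qIntegrand, ENNReal.ofReal_div_of_pos h]
  simp

theorem intervalIntegrable_two_div_sq {η : ℝ → ℝ}
    (hηloc : LocallyIntegrable (fun z => 1 / (η z) ^ 2) volume) (a b : ℝ) :
    IntervalIntegrable (fun z => 2 / (η z) ^ 2) volume a b := by
  have h := ((hηloc.integrableOn_isCompact isCompact_uIcc).intervalIntegrable
    (a := a) (b := b)).const_mul 2
  simpa [div_eq_mul_inv] using h

theorem continuous_integral_two_div_sq {η : ℝ → ℝ}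
    (hηloc : LocallyIntegrable (fun z => 1 / (η z) ^ 2) volume) (y : ℝ) :
    Continuous (fun u => ∫ z in y..u, 2 / (η z) ^ 2) :=
  intervalIntegral.continuous_primitive (intervalIntegrable_two_div_sq hηloc) y

theorem strictMono_integral_two_div_sq {η : ℝ → ℝ} (hηne : ∀ x, η x ≠ 0)
    (hηloc : LocallyIntegrable (fun z => 1 / (η z) ^ 2) volume) (y : ℝ) :
    StrictMono (fun u => ∫ z in y..u, 2 / (η z) ^ 2) := by
  intro a b hab
  have hi := intervalIntegrable_two_div_sq hηloc
  have hpos : 0 < ∫ z in a..b, 2 / (η z) ^ 2 :=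
    intervalIntegral.intervalIntegral_pos_of_pos (hi a b)
      (fun z => by have := hηne z; positivity) hab
  have := intervalIntegral.integral_add_adjacent_intervals (hi y a) (hi a b)
  dsimp only
  linarith

theorem hasDerivAt_qReal {η : ℝ → ℝ}
    (hηloc : LocallyIntegrable (fun z => 1 / (η z) ^ 2) volume) (y x : ℝ) :
    HasDerivAt (qReal η y) (∫ z in y..x, 2 / (η z) ^ 2) x :=
  (continuous_integral_two_div_sq hηloc y).integral_hasStrictDerivAt y x |>.hasDerivAt

theorem continuous_qReal {η : ℝ → ℝ}
    (hηloc : LocallyIntegrable (fun z => 1 / (η z) ^ 2) volume) (y : ℝ) :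
    Continuous (qReal η y) :=
  continuous_iff_continuousAt.2 fun x => (hasDerivAt_qReal hηloc y x).continuousAt

theorem strictConvexOn_qReal {η : ℝ → ℝ} (hηne : ∀ x, η x ≠ 0)
    (hηloc : LocallyIntegrable (fun z => 1 / (η z) ^ 2) volume) (y : ℝ) :
    StrictConvexOn ℝ univ (qReal η y) := by
  refine StrictMono.strictConvexOn_univ_of_deriv (continuous_qReal hηloc y) ?_
  rw [funext fun x => (hasDerivAt_qReal hηloc y x).deriv]
  exact strictMono_integral_two_div_sq hηne hηloc y

@[simp]
theorem qReal_self (η : ℝ → ℝ) (y : ℝ) : qReal η y y = 0 := by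
  simp [qReal]

theorem qReal_nonneg (η : ℝ → ℝ) (y x : ℝ) : 0 ≤ qReal η y x := by
  have hf : ∀ z, 0 ≤ 2 / (η z) ^ 2 := fun z => by positivity
  rcases le_total y x with h | h
  · exact intervalIntegral.integral_nonneg h fun u hu =>
      intervalIntegral.integral_nonneg hu.1 fun z _ => hf z
  · rw [qReal, intervalIntegral.integral_symm, ← intervalIntegral.integral_neg]
    refine intervalIntegral.integral_nonneg h fun u hu => ?_
    rw [← intervalIntegral.integral_symm]
    exact intervalIntegral.integral_nonneg hu.2 fun z _ => hf z

theorem eq_of_qReal_eq_zero {η : ℝ → ℝ} (hηne : ∀ x, η x ≠ 0)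
    (hηloc : LocallyIntegrable (fun z => 1 / (η z) ^ 2) volume) {y x : ℝ}
    (h : qReal η y x = 0) : x = y := by
  by_contra hne
  have := (strictConvexOn_qReal hηne hηloc y).2 (mem_univ x) (mem_univ y) hne
    (by norm_num : (0 : ℝ) < 1 / 2) (by norm_num : (0 : ℝ) < 1 / 2) (by norm_num)
  rw [h, qReal_self] at this
  simp only [smul_zero, add_zero] at this
  exact absurd this (not_lt.2 (qReal_nonneg _ _ _))

theorem lintegral_Ioc_ofReal_eq {f : ℝ → ℝ} {a b : ℝ} (hab : a ≤ b)
    (hf : IntervalIntegrable f volume a b) (hnn : ∀ z ∈ Ioc a b, 0 ≤ f z) :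
    ∫⁻ z in Ioc a b, ENNReal.ofReal (f z) = ENNReal.ofReal (∫ z in a..b, f z) := by
  rw [intervalIntegral.integral_of_le hab, ofReal_integral_eq_lintegral_ofReal]
  · exact (intervalIntegrable_iff_integrableOn_Ioc_of_le hab).1 hf
  · exact (ae_restrict_iff' measurableSet_Ioc).2 (ae_of_all _ hnn)

theorem qfun_eq_ofReal {η : ℝ → ℝ} (hηne : ∀ x, η x ≠ 0)
    (hηloc : LocallyIntegrable (fun z => 1 / (η z) ^ 2) volume) (y x : ℝ) :
    qfun η y x = ENNReal.ofReal (qReal η y x) := by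
  have hf : ∀ z, 0 ≤ 2 / (η z) ^ 2 := fun z => by positivity
  have hi := intervalIntegrable_two_div_sq hηloc
  have hF := continuous_integral_two_div_sq hηloc y
  simp only [qfun, qIntegrand_eq_ofReal hηne]
  split_ifs with h
  · rw [qReal, ← lintegral_Ioc_ofReal_eq h (hF.intervalIntegrable _ _)]
    · refine setLIntegral_congr_fun measurableSet_Ioc fun u hu => ?_
      exact lintegral_Ioc_ofReal_eq hu.1.le (hi _ _) fun z _ => hf z
    · exact fun u hu => intervalIntegral.integral_nonneg hu.1.le fun z _ => hf z
  · have h' := (not_le.1 h).le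
    rw [qReal, intervalIntegral.integral_symm, ← intervalIntegral.integral_neg,
      ← lintegral_Ioc_ofReal_eq h' (hF.fun_neg.intervalIntegrable _ _)]
    · refine setLIntegral_congr_fun measurableSet_Ioc fun u hu => ?_
      rw [← intervalIntegral.integral_symm]
      exact lintegral_Ioc_ofReal_eq hu.2 (hi _ _) fun z _ => hf z
    · intro u hu
      rw [← intervalIntegral.integral_symm]
      exact intervalIntegral.integral_nonneg hu.2 fun z _ => hf z

/-- Convexity of `q(y, ·)` along rays from its zero `y`. -/
theorem qReal_add_mul_le {η : ℝ → ℝ} (hηne : ∀ x, η x ≠ 0)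
    (hηloc : LocallyIntegrable (fun z => 1 / (η z) ^ 2) volume) (y x : ℝ) {a b : ℝ}
    (ha : 0 ≤ a) (hb : 0 < b) (hab : a ≤ b) :
    qReal η y (y + a * x) ≤ a / b * qReal η y (y + b * x) := by
  have h := (strictConvexOn_qReal hηne hηloc y).convexOn.2 (mem_univ (y + b * x)) (mem_univ y)
    (div_nonneg ha hb.le) (sub_nonneg.2 ((div_le_one hb).2 hab)) (add_sub_cancel _ _)
  simp only [qReal_self, smul_eq_mul, mul_zero, add_zero] at h
  have hx : a / b * (y + b * x) + (1 - a / b) * y = y + a * x := by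
    field_simp
    ring
  rwa [hx] at h

theorem eq_dirac_of_ae_eq {μ : Measure ℝ} [IsProbabilityMeasure μ] {c : ℝ}
    (h : ∀ᵐ x ∂μ, x = c) : μ = Measure.dirac c := by
  have h1 : μ.map (fun x => x) = μ.map (fun _ => c) := Measure.map_congr h
  rw [Measure.map_const, measure_univ, one_smul] at h1
  exact Measure.map_id'.symm.trans h1

/-- Case 1 (`I = ℝ`) under (A1): for every `y ∈ ℝ` the map `G_y` is a strictly increasing
continuous bijection from `[0,∞)` onto `[0,∞)`; in particular `G_y(0) = 0` and
`G_y(a) → ∞` as `a → ∞`. -/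
theorem Gfun_bijective_of_A1
    (η : ℝ → ℝ) (hηmeas : Measurable η) (hηne : ∀ x : ℝ, η x ≠ 0)
    (hηloc : LocallyIntegrable (fun z => 1 / (η z) ^ 2) volume)
    (μ : Measure ℝ) [IsProbabilityMeasure μ]
    (hμint : Integrable (fun x => x) μ) (hμcen : ∫ x, x ∂μ = 0)
    (hμne : μ ≠ Measure.dirac 0)
    (hA1 : ∀ y a : ℝ, 0 < a → Gfun η μ y a < ⊤) :
    ∀ y : ℝ,
      Gfun η μ y 0 = 0 ∧
      StrictMonoOn (fun a => (Gfun η μ y a).toReal) (Set.Ici 0) ∧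
      ContinuousOn (fun a => (Gfun η μ y a).toReal) (Set.Ici 0) ∧
      Set.BijOn (fun a => (Gfun η μ y a).toReal) (Set.Ici 0) (Set.Ici 0) ∧
      Tendsto (fun a => (Gfun η μ y a).toReal) atTop atTop := by
  intro y
  have hcont : ∀ a : ℝ, Continuous fun x => qReal η y (y + a * x) := fun a =>
    (continuous_qReal hηloc y).comp (by fun_prop)
  have hG : ∀ a, Gfun η μ y a = ∫⁻ x, ENNReal.ofReal (qReal η y (y + a * x)) ∂μ := fun a => by
    simp only [Gfun, qfun_eq_ofReal hηne hηloc]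
  have hG0 : Gfun η μ y 0 = 0 := by simp [hG]
  have hreal : ∀ a, (Gfun η μ y a).toReal = ∫ x, qReal η y (y + a * x) ∂μ := fun a => by
    rw [hG, integral_eq_lintegral_of_nonneg_ae (ae_of_all _ fun x => qReal_nonneg _ _ _)
      (hcont a).aestronglyMeasurable]
  have hint : ∀ a, 0 < a → Integrable (fun x => qReal η y (y + a * x)) μ := fun a ha => by
    refine ⟨(hcont a).aestronglyMeasurable, ?_⟩
    rw [hasFiniteIntegral_iff_ofReal (ae_of_all _ fun x => qReal_nonneg _ _ _), ← hG]
    exact hA1 y a ha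
  have hg0 : (Gfun η μ y 0).toReal = 0 := by simp [hG0]
  have hpos : ∀ a, 0 < a → 0 < (Gfun η μ y a).toReal := fun a ha => by
    refine lt_of_le_of_ne ENNReal.toReal_nonneg fun h0 => hμne (eq_dirac_of_ae_eq ?_)
    rw [hreal, eq_comm, integral_eq_zero_iff_of_nonneg (fun x => qReal_nonneg _ _ _)
      (hint a ha)] at h0
    filter_upwards [h0] with x hx
    have := eq_of_qReal_eq_zero hηne hηloc hx
    simpa [ha.ne'] using this
  have hstar : ∀ a b, 0 ≤ a → 0 < b → a ≤ b →
      (Gfun η μ y a).toReal ≤ a / b * (Gfun η μ y b).toReal := fun a b ha hb hab => by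
    rw [hreal, hreal, ← integral_const_mul]
    exact integral_mono_of_nonneg (ae_of_all _ fun x => qReal_nonneg _ _ _)
      ((hint b hb).const_mul _) (ae_of_all _ fun x => qReal_add_mul_le hηne hηloc y x ha hb hab)
  have hmono : StrictMonoOn (fun a => (Gfun η μ y a).toReal) (Ici 0) := by
    intro a ha b _ hab
    have hb : 0 < b := lt_of_le_of_lt ha hab
    exact (hstar a b ha hb hab.le).trans_lt
      (mul_lt_of_lt_one_left (hpos b hb) ((div_lt_one hb).2 hab))
  have hcontG : ContinuousOn (fun a => (Gfun η μ y a).toReal) (Ici 0) := by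
    intro a ha
    have ha1 : 0 < a + 1 := by have : 0 ≤ a := ha; linarith
    simp only [hreal]
    refine continuousWithinAt_of_dominated (bound := fun x => qReal η y (y + (a + 1) * x))
      (Eventually.of_forall fun b => (hcont b).aestronglyMeasurable) ?_ (hint _ ha1)
      (ae_of_all _ fun x => ((continuous_qReal hηloc y).comp (by fun_prop :
        Continuous fun b : ℝ => y + b * x)).continuousWithinAt)
    filter_upwards [self_mem_nhdsWithin,
      mem_nhdsWithin_of_mem_nhds (Iic_mem_nhds (lt_add_one a))] with b hb hb1
    refine ae_of_all _ fun x => ?_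
    rw [Real.norm_of_nonneg (qReal_nonneg _ _ _)]
    exact (qReal_add_mul_le hηne hηloc y x hb ha1 hb1).trans
      (mul_le_of_le_one_left (qReal_nonneg _ _ _) ((div_le_one ha1).2 hb1))
  have htop : Tendsto (fun a => (Gfun η μ y a).toReal) atTop atTop := by
    refine tendsto_atTop_mono' _ ?_ (tendsto_id.atTop_mul_const (hpos 1 one_pos))
    filter_upwards [eventually_ge_atTop 1] with a ha
    have ha0 : 0 < a := by linarith
    have := hstar 1 a zero_le_one ha0 ha
    rwa [one_div, inv_mul_eq_div, le_div_iff₀' ha0] at this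
  refine ⟨hG0, hmono, hcontG, ⟨fun a _ => ENNReal.toReal_nonneg, hmono.injOn, fun c hc => ?_⟩,
    htop⟩
  obtain ⟨b, hbc, hb⟩ := ((htop.eventually_ge_atTop c).and (eventually_ge_atTop 0)).exists
  obtain ⟨a, ha, hac⟩ := intermediate_value_Icc hb (hcontG.mono Icc_subset_Ici_self)
    (show c ∈ Icc _ _ from ⟨hg0.trans_le hc, hbc⟩)
  exact ⟨a, ha.1, hac⟩
end

section
/- Positive infimum on compacts: Assume the Case 2 setting and condition (A2). Then for every compact subinterval J ⊂ I one has inf_{y ∈ J} G_y(ā(y)) > 0. -/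
open MeasureTheory Filter Set Topology
open scoped ENNReal

theorem qIntegrand_pos (η : ℝ → ℝ) (z : ℝ) : 0 < qIntegrand η z :=
  ENNReal.div_pos two_ne_zero ENNReal.ofReal_ne_top

theorem measurable_qIntegrand {η : ℝ → ℝ} (hη : Measurable η) : Measurable (qIntegrand η) :=
  (hη.pow_const 2).ennreal_ofReal.const_div 2

theorem setLIntegral_qIntegrand_pos {η : ℝ → ℝ} (hη : Measurable η) {a b : ℝ} (hab : a < b) :
    0 < ∫⁻ z in Set.Ioc a b, qIntegrand η z := by
  rw [setLIntegral_pos_iff (measurable_qIntegrand hη)]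
  have hsupp : Function.support (qIntegrand η) = Set.univ :=
    Set.eq_univ_of_forall fun z => (qIntegrand_pos η z).ne'
  simp [hsupp, hab]

/-- A uniform lower bound for the integrals of `qIntegrand η` over the intervals
`(y - 2h, y]` with `y` in a bounded set: each contains a cell of the grid `hℤ`. -/
theorem exists_pos_le_setLIntegral_qIntegrand {η : ℝ → ℝ} (hη : Measurable η) {h : ℝ}
    (hh : 0 < h) (c₁ d₁ : ℝ) :
    ∃ m : ℝ≥0∞, 0 < m ∧ ∀ y ∈ Set.Icc c₁ d₁,
      m ≤ ∫⁻ z in Set.Ioc (y - 2 * h) y, qIntegrand η z := by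
  let g : ℤ → ℝ≥0∞ := fun k => ∫⁻ z in Set.Ioc ((k - 1) * h) (k * h), qIntegrand η z
  refine ⟨(Finset.Icc ⌊c₁ / h⌋ ⌊d₁ / h⌋).inf g, ?_, fun y hy => ?_⟩
  · rw [Finset.lt_inf_iff ENNReal.zero_lt_top]
    exact fun k _ => setLIntegral_qIntegrand_pos hη (by nlinarith)
  · have hmem : ⌊y / h⌋ ∈ Finset.Icc ⌊c₁ / h⌋ ⌊d₁ / h⌋ :=
      Finset.mem_Icc.2 ⟨Int.floor_le_floor (by gcongr; exact hy.1),
        Int.floor_le_floor (by gcongr; exact hy.2)⟩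
    refine (Finset.inf_le hmem).trans (lintegral_mono_set (Set.Ioc_subset_Ioc ?_ ?_))
    · have := (div_lt_iff₀ hh).1 (Int.lt_floor_add_one (y / h))
      linarith
    · exact (le_div_iff₀ hh).1 (Int.floor_le (y / h))

theorem le_qfun_of_le_sub {η : ℝ → ℝ} {y x h : ℝ} {m : ℝ≥0∞} (hh : 0 < h) (hx : x ≤ y - 4 * h)
    (hm : m ≤ ∫⁻ z in Set.Ioc (y - 2 * h) y, qIntegrand η z) :
    m * ENNReal.ofReal (2 * h) ≤ qfun η y x := by
  rw [qfun, if_neg (by linarith)]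
  calc m * ENNReal.ofReal (2 * h)
      = ∫⁻ _ in Set.Ioc (y - 4 * h) (y - 2 * h), m := by
        rw [setLIntegral_const, Real.volume_Ioc]; congr 2; ring
    _ ≤ ∫⁻ u in Set.Ioc (y - 4 * h) (y - 2 * h), ∫⁻ z in Set.Ioc u y, qIntegrand η z :=
        setLIntegral_mono' measurableSet_Ioc fun u hu =>
          hm.trans (lintegral_mono_set (Set.Ioc_subset_Ioc_left hu.2))
    _ ≤ _ := lintegral_mono_set (Set.Ioc_subset_Ioc hx (by linarith))

theorem eq_dirac_zero_of_ae_nonneg_of_integral_eq_zero {μ : Measure ℝ} [IsProbabilityMeasure μ]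
    (hint : Integrable (fun x => x) μ) (hcen : ∫ x, x ∂μ = 0) (hnonneg : ∀ᵐ x ∂μ, 0 ≤ x) :
    μ = Measure.dirac 0 := by
  have h0 : (fun x : ℝ => x) =ᵐ[μ] fun _ => (0 : ℝ) :=
    (integral_eq_zero_iff_of_nonneg_ae hnonneg hint).1 hcen
  simpa [Measure.map_const] using Measure.map_congr h0

/-- **Positive infimum on compacts** (Case 2: `I = (l,∞)`, condition (A2)).
Here `c = inf supp μ` and `ā(y) = (l−y)/c`.  For every compact subinterval
`J = [c₁, d₁] ⊂ I` one has `inf_{y ∈ J} G_y(ā(y)) > 0`. -/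
theorem Gfun_abar_pos_inf_on_compacts
    (l : ℝ) (η : ℝ → ℝ) (hηmeas : Measurable η)
    (hηne : ∀ x ∈ Set.Ioi l, η x ≠ 0) (hηzero : ∀ x ∉ Set.Ioi l, η x = 0)
    (hηloc : LocallyIntegrableOn (fun z => 1 / (η z) ^ 2) (Set.Ioi l) volume)
    (μ : Measure ℝ) [IsProbabilityMeasure μ]
    (hμint : Integrable (fun x => x) μ) (hμcen : ∫ x, x ∂μ = 0)
    (hμne : μ ≠ Measure.dirac 0)
    (c : ℝ) (hc_null : μ (Set.Iio c) = 0) (hc_inf : ∀ ε > (0 : ℝ), 0 < μ (Set.Iio (c + ε)))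
    (hA2 : ∃ y ∈ Set.Ioi l, ∀ a : ℝ, 0 < a →
      ∫⁻ x in Set.Ici (0 : ℝ), qfun η y (y + a * x) ∂μ < ⊤) :
    ∀ c₁ d₁ : ℝ, l < c₁ →
      ∃ ε : ℝ≥0∞, 0 < ε ∧ ∀ y ∈ Set.Icc c₁ d₁, ε ≤ Gfun η μ y ((l - y) / c) := by
  intro c₁ d₁ hlc
  have hc : c < 0 := by
    by_contra! hc
    refine hμne (eq_dirac_zero_of_ae_nonneg_of_integral_eq_zero hμint hμcen ?_)
    filter_upwards [measure_eq_zero_iff_ae_notMem.1 hc_null] with x hx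
    exact hc.trans (not_lt.1 hx)
  obtain ⟨h, hh, h8⟩ : ∃ h : ℝ, 0 < h ∧ 8 * h = c₁ - l := ⟨(c₁ - l) / 8, by linarith, by ring⟩
  obtain ⟨m, hm, hmle⟩ := exists_pos_le_setLIntegral_qIntegrand hηmeas hh c₁ d₁
  have hμpos : 0 < μ (Set.Iio (c / 2)) := by
    convert hc_inf (-c / 2) (by linarith) using 3
    ring
  refine ⟨m * ENNReal.ofReal (2 * h) * μ (Set.Iio (c / 2)), ?_, fun y hy => ?_⟩
  · exact ENNReal.mul_pos (ENNReal.mul_pos hm.ne' (by simpa using hh)).ne' hμpos.ne'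
  · rw [← setLIntegral_const]
    refine (setLIntegral_mono' measurableSet_Iio fun x hx => ?_).trans
      (setLIntegral_le_lintegral _ _)
    refine le_qfun_of_le_sub hh ?_ (hmle y hy)
    have hy1 := hy.1
    have ha : 0 ≤ (l - y) / c := div_nonneg_of_nonpos (by linarith) hc.le
    have hac : (l - y) / c * c = l - y := div_mul_cancel₀ _ hc.ne
    have := mul_le_mul_of_nonneg_left (le_of_lt (Set.mem_Iio.1 hx)) ha
    linarith
end

section
/- Assume the Case 4 setting and condition (A3). If limsup_{x↘l} |η(x)|/(x−l) < ∞, then liminf_{y↘l} G_y(ā(y)) > 0. If limsup_{x↗r} |η(x)|/(r−x) < ∞, then liminf_{y↗r} G_y(ā(y)) > 0. -/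
open MeasureTheory Filter Set Topology
open scoped ENNReal

lemma eq_dirac_zero_of_ae_eq_zero {μ : Measure ℝ} [IsProbabilityMeasure μ]
    (h : (fun x : ℝ => x) =ᵐ[μ] 0) : μ = Measure.dirac 0 := by
  have h1 : μ.map (fun x : ℝ => x) = μ.map (fun _ => (0 : ℝ)) := Measure.map_congr h
  simpa [Measure.map_const, Measure.map_id'] using h1

lemma inf_support_neg {μ : Measure ℝ} [IsProbabilityMeasure μ]
    (hint : Integrable (fun x => x) μ) (hcen : ∫ x, x ∂μ = 0) (hne : μ ≠ Measure.dirac 0)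
    {c : ℝ} (hc : μ (Set.Iio c) = 0) : c < 0 := by
  by_contra! h
  have hae : 0 ≤ᵐ[μ] fun x : ℝ => x := by
    filter_upwards [measure_eq_zero_iff_ae_notMem.1 hc] with x hx
    exact h.trans (not_lt.1 hx)
  exact hne (eq_dirac_zero_of_ae_eq_zero ((integral_eq_zero_iff_of_nonneg_ae hae hint).1 hcen))

lemma sup_support_pos {μ : Measure ℝ} [IsProbabilityMeasure μ]
    (hint : Integrable (fun x => x) μ) (hcen : ∫ x, x ∂μ = 0) (hne : μ ≠ Measure.dirac 0)
    {d : ℝ} (hd : μ (Set.Ioi d) = 0) : 0 < d := by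
  by_contra! h
  have hae : 0 ≤ᵐ[μ] fun x : ℝ => -x := by
    filter_upwards [measure_eq_zero_iff_ae_notMem.1 hd] with x hx
    exact neg_nonneg.2 ((not_lt.1 hx).trans h)
  have h0 := (integral_eq_zero_iff_of_nonneg_ae hae hint.neg).1 (by rw [integral_neg, hcen, neg_zero])
  refine hne (eq_dirac_zero_of_ae_eq_zero ?_)
  filter_upwards [h0] with x hx
  simpa using hx

lemma ofReal_one_div_le_two_div_mul {C s : ℝ} (hC : 0 < C) (hs : 0 < s) :
    ENNReal.ofReal (1 / (8 * C ^ 2)) ≤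
      2 / ENNReal.ofReal ((C * s) ^ 2) * ENNReal.ofReal (s / 4) * ENNReal.ofReal (s / 4) := by
  have h2 : (2 : ℝ≥0∞) = ENNReal.ofReal 2 := by simp
  rw [h2, ← ENNReal.ofReal_div_of_pos (by positivity), ← ENNReal.ofReal_mul (by positivity),
    ← ENNReal.ofReal_mul (by positivity)]
  refine ENNReal.ofReal_le_ofReal (le_of_eq ?_)
  field_simp
  norm_num

lemma le_qIntegrand_of_abs_le {η : ℝ → ℝ} {z K : ℝ} (h : |η z| ≤ K) :
    2 / ENNReal.ofReal (K ^ 2) ≤ qIntegrand η z := by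
  unfold qIntegrand
  gcongr 2 / ENNReal.ofReal ?_
  exact sq_le_sq' (abs_le.1 h).1 (abs_le.1 h).2

/-- A lower bound for an iterated integral over `S` and `T u` by a product of lengths. -/
lemma mul_le_setLIntegral_setLIntegral {f : ℝ → ℝ≥0∞} {S S' T' : Set ℝ} {T : ℝ → Set ℝ}
    {K : ℝ≥0∞} (hS' : MeasurableSet S') (hT' : MeasurableSet T') (hS : S' ⊆ S)
    (hT : ∀ u ∈ S', T' ⊆ T u) (hf : ∀ z ∈ T', K ≤ f z) :
    K * volume T' * volume S' ≤ ∫⁻ u in S, ∫⁻ z in T u, f z := by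
  calc K * volume T' * volume S' = ∫⁻ _ in S', ∫⁻ _ in T', K := by simp
    _ ≤ ∫⁻ u in S', ∫⁻ z in T u, f z :=
      setLIntegral_mono' hS' fun u hu =>
        (setLIntegral_mono' hT' hf).trans (lintegral_mono_set (hT u hu))
    _ ≤ _ := lintegral_mono_set hS

lemma le_qfun_of_abs_le_left {η : ℝ → ℝ} {C s x y : ℝ} (hC : 0 < C) (hs : 0 < s)
    (hη : ∀ z ≤ y, |η z| ≤ C * s) (hx : x ≤ y - s / 2) :
    ENNReal.ofReal (1 / (8 * C ^ 2)) ≤ qfun η y x := by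
  rw [qfun, if_neg (by linarith)]
  refine le_trans ?_ (mul_le_setLIntegral_setLIntegral
    (measurableSet_Ioc (a := y - s / 2) (b := y - s / 4))
    (measurableSet_Ioc (a := y - s / 4) (b := y))
    (Set.Ioc_subset_Ioc hx (by linarith)) (fun u hu => Set.Ioc_subset_Ioc_left hu.2)
    (fun z hz => le_qIntegrand_of_abs_le (hη z hz.2)))
  rw [Real.volume_Ioc, Real.volume_Ioc, show y - (y - s / 4) = s / 4 by ring,
    show y - s / 4 - (y - s / 2) = s / 4 by ring]
  exact ofReal_one_div_le_two_div_mul hC hs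

lemma le_qfun_of_abs_le_right {η : ℝ → ℝ} {C s x y : ℝ} (hC : 0 < C) (hs : 0 < s)
    (hη : ∀ z ≥ y, |η z| ≤ C * s) (hx : y + s / 2 ≤ x) :
    ENNReal.ofReal (1 / (8 * C ^ 2)) ≤ qfun η y x := by
  rw [qfun, if_pos (by linarith)]
  refine le_trans ?_ (mul_le_setLIntegral_setLIntegral
    (measurableSet_Ioc (a := y + s / 4) (b := y + s / 2))
    (measurableSet_Ioc (a := y) (b := y + s / 4))
    (Set.Ioc_subset_Ioc (by linarith) hx) (fun u hu => Set.Ioc_subset_Ioc_right hu.1.le)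
    (fun z hz => le_qIntegrand_of_abs_le (hη z hz.1.le)))
  rw [Real.volume_Ioc, Real.volume_Ioc, show y + s / 4 - y = s / 4 by ring,
    show y + s / 2 - (y + s / 4) = s / 4 by ring]
  exact ofReal_one_div_le_two_div_mul hC hs

lemma mul_measure_le_Gfun {η : ℝ → ℝ} {μ : Measure ℝ} {y a : ℝ} {S : Set ℝ} {K : ℝ≥0∞}
    (hS : MeasurableSet S) (h : ∀ x ∈ S, K ≤ qfun η y (y + a * x)) :
    K * μ S ≤ Gfun η μ y a := by
  calc K * μ S = ∫⁻ _ in S, K ∂μ := (setLIntegral_const S K).symm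
    _ ≤ ∫⁻ x in S, qfun η y (y + a * x) ∂μ := setLIntegral_mono' hS h
    _ ≤ Gfun η μ y a := setLIntegral_le_lintegral S _

lemma liminf_pos_of_eventually_le {f : Filter ℝ} {u : ℝ → ℝ≥0∞} {C : ℝ} {m : ℝ≥0∞} (hC : 0 < C)
    (hm : 0 < m) (h : ∀ᶠ y in f, ENNReal.ofReal (1 / (8 * C ^ 2)) * m ≤ u y) :
    0 < liminf u f :=
  (ENNReal.mul_pos (ENNReal.ofReal_pos.2 (by positivity)).ne' hm.ne').trans_le
    (le_liminf_of_le (by isBoundedDefault) h)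

/-- Case 4 (`I = (l,r)` with `l, r` finite), condition (A3):
if `limsup_{x↘l} |η(x)|/(x−l) < ∞` then `liminf_{y↘l} G_y(ā(y)) > 0`, and if
`limsup_{x↗r} |η(x)|/(r−x) < ∞` then `liminf_{y↗r} G_y(ā(y)) > 0`.
Here `c = inf supp μ < 0 < d = sup supp μ` and `ā(y) = min((l−y)/c, (r−y)/d)`. -/
theorem Gfun_abar_liminf_pos_case4
    (l r : ℝ) (hlr : l < r) (η : ℝ → ℝ) (hηmeas : Measurable η)
    (hηne : ∀ x ∈ Set.Ioo l r, η x ≠ 0) (hηzero : ∀ x ∉ Set.Ioo l r, η x = 0)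
    (hηloc : LocallyIntegrableOn (fun z => 1 / (η z) ^ 2) (Set.Ioo l r) volume)
    (μ : Measure ℝ) [IsProbabilityMeasure μ]
    (hμint : Integrable (fun x => x) μ) (hμcen : ∫ x, x ∂μ = 0)
    (hμne : μ ≠ Measure.dirac 0)
    (c : ℝ) (hc_null : μ (Set.Iio c) = 0) (hc_inf : ∀ ε > (0 : ℝ), 0 < μ (Set.Iio (c + ε)))
    (d : ℝ) (hd_null : μ (Set.Ioi d) = 0) (hd_sup : ∀ ε > (0 : ℝ), 0 < μ (Set.Ioi (d - ε))) :
    ((∃ C : ℝ, ∀ᶠ x in 𝓝[>] l, |η x| ≤ C * (x - l)) →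
      0 < Filter.liminf (fun y => Gfun η μ y (min ((l - y) / c) ((r - y) / d))) (𝓝[>] l)) ∧
    ((∃ C : ℝ, ∀ᶠ x in 𝓝[<] r, |η x| ≤ C * (r - x)) →
      0 < Filter.liminf (fun y => Gfun η μ y (min ((l - y) / c) ((r - y) / d))) (𝓝[<] r)) := by
  have hc : c < 0 := inf_support_neg hμint hμcen hμne hc_null
  have hd : 0 < d := sup_support_pos hμint hμcen hμne hd_null
  constructor
  · rintro ⟨C, hC⟩
    obtain ⟨b, hb, hCb⟩ := mem_nhdsGT_iff_exists_Ioo_subset.1 hC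
    have hK : 0 < max C 1 := lt_max_of_lt_right one_pos
    refine liminf_pos_of_eventually_le hK (hc_inf (-c / 2) (by linarith)) ?_
    have hmin : ∀ᶠ y in 𝓝[>] l, (l - y) / c < (r - y) / d := by
      refine nhdsWithin_le_nhds ((isOpen_lt (by fun_prop) (by fun_prop)).mem_nhds ?_)
      simpa using div_pos (sub_pos.2 hlr) hd
    filter_upwards [hmin, Ioo_mem_nhdsGT hb] with y hy hyb
    rw [min_eq_left hy.le]
    refine mul_measure_le_Gfun measurableSet_Iio fun x hx =>
      le_qfun_of_abs_le_left hK (sub_pos.2 hyb.1) (fun z hz => ?_) ?_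
    · rcases le_or_gt z l with hzl | hzl
      · rw [hηzero z fun h => h.1.not_ge hzl, abs_zero]
        exact mul_nonneg hK.le (sub_pos.2 hyb.1).le
      · calc |η z| ≤ C * (z - l) := hCb ⟨hzl, hz.trans_lt hyb.2⟩
          _ ≤ max C 1 * (y - l) :=
            mul_le_mul (le_max_left _ _) (by linarith) (by linarith) hK.le
    · have ha : 0 < (l - y) / c := div_pos_of_neg_of_neg (sub_neg.2 hyb.1) hc
      have h1 := mul_le_mul_of_nonneg_left (le_of_lt (Set.mem_Iio.1 hx)) ha.le
      have h2 : (l - y) / c * (c + -c / 2) = (l - y) / 2 := by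
        rw [div_mul_eq_mul_div, div_eq_iff hc.ne]
        ring
      linarith
  · rintro ⟨C, hC⟩
    obtain ⟨b, hb, hCb⟩ := mem_nhdsLT_iff_exists_Ioo_subset.1 hC
    have hK : 0 < max C 1 := lt_max_of_lt_right one_pos
    refine liminf_pos_of_eventually_le hK (hd_sup (d / 2) (by linarith)) ?_
    have hmin : ∀ᶠ y in 𝓝[<] r, (r - y) / d < (l - y) / c := by
      refine nhdsWithin_le_nhds ((isOpen_lt (by fun_prop) (by fun_prop)).mem_nhds ?_)
      simpa using div_pos_of_neg_of_neg (sub_neg.2 hlr) hc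
    filter_upwards [hmin, Ioo_mem_nhdsLT hb] with y hy hyb
    rw [min_eq_right hy.le]
    refine mul_measure_le_Gfun measurableSet_Ioi fun x hx =>
      le_qfun_of_abs_le_right hK (sub_pos.2 hyb.2) (fun z hz => ?_) ?_
    · rcases le_or_gt r z with hzr | hzr
      · rw [hηzero z fun h => h.2.not_ge hzr, abs_zero]
        exact mul_nonneg hK.le (sub_pos.2 hyb.2).le
      · calc |η z| ≤ C * (r - z) := hCb ⟨hyb.1.trans_le hz, hzr⟩
          _ ≤ max C 1 * (r - y) :=
            mul_le_mul (le_max_left _ _) (by linarith) (by linarith) hK.le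
    · have ha : 0 < (r - y) / d := div_pos (sub_pos.2 hyb.2) hd
      have h1 := mul_le_mul_of_nonneg_left (le_of_lt (Set.mem_Ioi.1 hx)) ha.le
      have h2 : (r - y) / d * (d - d / 2) = (r - y) / 2 := by
        rw [div_mul_eq_mul_div, div_eq_iff hd.ne']
        ring
      linarith
end
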